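/- arXiv:1411.6404 — 4 statements merged into one kernel-verified Lean document; each statement's English description precedes it below -/
import Mathlib

section
/- Let 0 < β < 1 and λ ≥ 0. The function u(t) = E_β(−λ t^β) = Σ_{k=0}^∞ (−λ)^k t^{βk} / Γ(βk+1) is differentiable at every t > 0, and its derivative is given by termwise differentiation: u'(t) = Σ_{k=1}^∞ (−λ)^k βk t^{βk−1} / Γ(βk+1). -/
theorem Real.rpow_mul_exp_neg_le_Gamma_add_one {R x : ℝ} (hR : 0 ≤ R) (hx : 0 ≤ x) :
    R ^ x * Real.exp (-R) ≤ Real.Gamma (x + 1) := by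
  have hconv := Real.GammaIntegral_convergent (s := x + 1) (by positivity)
  rw [Real.Gamma_eq_integral (by positivity), ← integral_exp_neg_Ioi R,
    ← MeasureTheory.integral_const_mul]
  have hsub : Set.Ioi R ⊆ Set.Ioi 0 := Set.Ioi_subset_Ioi hR
  calc ∫ y in Set.Ioi R, R ^ x * Real.exp (-y)
      ≤ ∫ y in Set.Ioi R, Real.exp (-y) * y ^ (x + 1 - 1) := by
        refine MeasureTheory.setIntegral_mono_on ((integrableOn_exp_neg_Ioi R).const_mul _)
          (hconv.mono_set hsub) measurableSet_Ioi fun y hy => ?_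
        rw [mul_comm, add_sub_cancel_right]
        gcongr
        exact le_of_lt hy
    _ ≤ ∫ y in Set.Ioi 0, Real.exp (-y) * y ^ (x + 1 - 1) := by
        refine MeasureTheory.setIntegral_mono_set hconv ?_ hsub.eventuallyLE
        filter_upwards [MeasureTheory.ae_restrict_mem measurableSet_Ioi] with y hy
        have : 0 < y := hy
        simp only [Pi.zero_apply]
        positivity

theorem Real.summable_pow_mul_pow_div_Gamma {β c : ℝ} (hβ : 0 < β) (hc : 0 ≤ c) (m : ℕ) :
    Summable fun n : ℕ => (n : ℝ) ^ m * c ^ n / Real.Gamma (β * n + 1) := by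
  set R : ℝ := (2 * c + 1) ^ β⁻¹ with hR
  have hR0 : 0 < R := by positivity
  have hr : ‖c / (2 * c + 1)‖ < 1 := by
    rw [Real.norm_of_nonneg (by positivity), div_lt_one (by positivity)]
    linarith
  refine ((summable_pow_mul_geometric_of_norm_lt_one m hr).mul_right (Real.exp R)).of_nonneg_of_le
    (fun n => ?_) fun n => ?_
  · have := Real.Gamma_pos_of_pos (s := β * n + 1) (by positivity)
    positivity
  · have hRn : R ^ (β * n) = (2 * c + 1) ^ n := by
      rw [Real.rpow_mul hR0.le, hR, Real.rpow_inv_rpow (by positivity) hβ.ne', Real.rpow_natCast]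
    have hG := Real.rpow_mul_exp_neg_le_Gamma_add_one (R := R) (x := β * n) hR0.le (by positivity)
    rw [hRn] at hG
    calc (n : ℝ) ^ m * c ^ n / Real.Gamma (β * n + 1)
        ≤ (n : ℝ) ^ m * c ^ n / ((2 * c + 1) ^ n * Real.exp (-R)) := by gcongr
      _ = (n : ℝ) ^ m * (c / (2 * c + 1)) ^ n * Real.exp R := by
        rw [Real.exp_neg, div_pow]
        field_simp

/-- For `0 < β < 1` and `λ ≥ 0`, the function
`u(t) = E_β(−λ t^β) = Σ_{k=0}^∞ (−λ)^k t^{βk} / Γ(βk+1)` is differentiable at every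
`t > 0`, with derivative given by termwise differentiation:
`u'(t) = Σ_{k=1}^∞ (−λ)^k βk t^{βk−1} / Γ(βk+1)`. -/
theorem mittagLeffler_hasDerivAt (β lam t : ℝ) (hβ0 : 0 < β) (hβ1 : β < 1)
    (hlam : 0 ≤ lam) (ht : 0 < t) :
    HasDerivAt (fun s : ℝ => ∑' k : ℕ, (-lam) ^ k * s ^ (β * k) / Real.Gamma (β * k + 1))
      (∑' k : ℕ, (-lam) ^ (k + 1) * (β * (k + 1)) * t ^ (β * (k + 1) - 1) /
        Real.Gamma (β * (k + 1) + 1)) t := by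
  have hΓ (n : ℕ) : 0 < Real.Gamma (β * n + 1) := Real.Gamma_pos_of_pos (by positivity)
  have hpow (s : ℝ) (hs : 0 < s) (n : ℕ) : lam ^ n * s ^ (β * n) = (lam * s ^ β) ^ n := by
    rw [mul_pow, Real.rpow_mul hs.le, Real.rpow_natCast]
  have htmem : t ∈ Set.Ioo (t / 2) (2 * t) := ⟨by linarith, by linarith⟩
  have hu := (Real.summable_pow_mul_pow_div_Gamma hβ0
    (c := lam * (2 * t) ^ β) (by positivity) 1).mul_left (β * (2 / t))
  have hbound (n : ℕ) (s : ℝ) (hs : s ∈ Set.Ioo (t / 2) (2 * t)) :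
      ‖(-lam) ^ n * (β * n * s ^ (β * n - 1)) / Real.Gamma (β * n + 1)‖ ≤
        β * (2 / t) * ((n : ℝ) ^ 1 * (lam * (2 * t) ^ β) ^ n / Real.Gamma (β * n + 1)) := by
    have hs0 : 0 < s := by linarith [hs.1]
    have hinv : s⁻¹ ≤ 2 / t := by
      rw [← inv_div]
      exact inv_anti₀ (by positivity) hs.1.le
    rw [norm_div, norm_mul, norm_pow, norm_neg, Real.norm_of_nonneg hlam,
      Real.norm_of_nonneg (by positivity : 0 ≤ β * n * s ^ (β * n - 1)),
      Real.norm_of_nonneg (hΓ n).le, ← hpow _ (by positivity), Real.rpow_sub_one hs0.ne']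
    calc lam ^ n * (β * n * (s ^ (β * n) / s)) / Real.Gamma (β * n + 1)
        = β * s⁻¹ * ((n : ℝ) ^ 1 * (lam ^ n * s ^ (β * n)) / Real.Gamma (β * n + 1)) := by
          ring
      _ ≤ _ := by
          have := hΓ n
          have := hs.2.le
          gcongr
  have hsum : Summable fun n : ℕ => (-lam) ^ n * t ^ (β * n) / Real.Gamma (β * n + 1) := by
    refine (Real.summable_pow_mul_pow_div_Gamma hβ0
      (c := lam * t ^ β) (by positivity) 0).of_norm_bounded fun n => le_of_eq ?_
    rw [norm_div, norm_mul, norm_pow, norm_neg, Real.norm_of_nonneg hlam,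
      Real.norm_of_nonneg (by positivity : 0 ≤ t ^ (β * n)),
      Real.norm_of_nonneg (hΓ n).le, hpow t ht, pow_zero, one_mul]
  have hderiv := hasDerivAt_tsum_of_isPreconnected hu isOpen_Ioo isPreconnected_Ioo
    (g := fun (n : ℕ) (s : ℝ) => (-lam) ^ n * s ^ (β * n) / Real.Gamma (β * n + 1))
    (fun n s hs => ((Real.hasDerivAt_rpow_const
      (Or.inl (by linarith [hs.1] : 0 < s).ne')).const_mul _).div_const _) hbound htmem hsum htmem
  rw [(hu.of_norm_bounded fun n => hbound n t htmem).tsum_eq_zero_add] at hderiv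
  simpa [mul_assoc] using hderiv
end

section
/- Let 0 < β < 1, a > 0 and t ≥ 0. Then the series Σ_{h=1}^∞ E_β(−a (t+h)^β) diverges, i.e. the family h ↦ E_β(−a(t+h)^β), h ∈ {1,2,3,…}, is not summable. -/
/-- The Mittag-Leffler function `E_β(x) = Σ_{k=0}^∞ x^k / Γ(βk+1)`. -/
noncomputable def mittagLeffler (β x : ℝ) : ℝ :=
  ∑' k : ℕ, x ^ k / Real.Gamma (β * k + 1)

open Finset Filter Topology

/-- The `n`-th Taylor coefficient of `(1 - x) ^ (-α)` at `0`. -/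
noncomputable def negBinomCoeff (α : ℝ) (n : ℕ) : ℝ :=
  ∏ i ∈ range n, (α + i) / (i + 1)

namespace negBinomCoeff

@[simp]
theorem zero_right (α : ℝ) : negBinomCoeff α 0 = 1 := by simp [negBinomCoeff]

theorem succ (α : ℝ) (n : ℕ) :
    negBinomCoeff α (n + 1) = negBinomCoeff α n * ((α + n) / (n + 1)) := by
  rw [negBinomCoeff, prod_range_succ, ← negBinomCoeff]

theorem succ_mul (α : ℝ) (n : ℕ) :
    (n + 1 : ℝ) * negBinomCoeff α (n + 1) = (α + n) * negBinomCoeff α n := by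
  rw [succ]
  field_simp

@[simp]
theorem one_left (n : ℕ) : negBinomCoeff 1 n = 1 := by
  induction n with
  | zero => simp
  | succ n ih =>
    rw [succ, ih, one_mul, add_comm (1 : ℝ), div_self (by positivity)]

theorem pos {α : ℝ} (hα : 0 < α) (n : ℕ) : 0 < negBinomCoeff α n :=
  prod_pos fun _ _ => by positivity

theorem neg_nonpos {β : ℝ} (hβ0 : 0 < β) (hβ1 : β < 1) (n : ℕ) :
    negBinomCoeff (-β) (n + 1) ≤ 0 := by
  induction n with
  | zero => simpa [negBinomCoeff] using hβ0.le
  | succ n ih =>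
    rw [succ]
    refine mul_nonpos_of_nonpos_of_nonneg ih (div_nonneg ?_ (by positivity))
    push_cast
    linarith [(n.cast_nonneg : (0 : ℝ) ≤ n)]

theorem antitone {α : ℝ} (hα0 : 0 < α) (hα1 : α ≤ 1) : Antitone (negBinomCoeff α) := by
  refine antitone_nat_of_succ_le fun n => ?_
  rw [succ]
  refine mul_le_of_le_one_right (pos hα0 n).le ?_
  rw [div_le_one (by positivity)]
  linarith

/-- The Chu–Vandermonde identity. -/
theorem sum_antidiagonal_mul (α γ : ℝ) (n : ℕ) :
    ∑ p ∈ antidiagonal n, negBinomCoeff α p.1 * negBinomCoeff γ p.2 =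
      negBinomCoeff (α + γ) n := by
  induction n with
  | zero => simp
  | succ n ih =>
    have hn : (n + 1 : ℝ) ≠ 0 := by positivity
    refine mul_left_cancel₀ hn ?_
    have hsplit : (n + 1 : ℝ) * ∑ p ∈ antidiagonal (n + 1),
          negBinomCoeff α p.1 * negBinomCoeff γ p.2 =
        (∑ p ∈ antidiagonal (n + 1), (p.1 : ℝ) * negBinomCoeff α p.1 * negBinomCoeff γ p.2) +
        ∑ p ∈ antidiagonal (n + 1), (p.2 : ℝ) * negBinomCoeff α p.1 * negBinomCoeff γ p.2 := by
      rw [mul_sum, ← sum_add_distrib]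
      refine sum_congr rfl fun p hp => ?_
      have hp' : (p.1 : ℝ) + p.2 = n + 1 := by exact_mod_cast mem_antidiagonal.1 hp
      rw [← hp']
      ring
    rw [hsplit, Finset.Nat.sum_antidiagonal_succ, Finset.Nat.sum_antidiagonal_succ', succ_mul,
      ← ih, mul_sum]
    simp only [Nat.cast_zero, zero_mul, zero_add, Nat.cast_add, Nat.cast_one]
    rw [← sum_add_distrib]
    refine sum_congr rfl fun p hp => ?_
    have hp' : (p.1 : ℝ) + p.2 = n := by exact_mod_cast mem_antidiagonal.1 hp
    have h₁ := succ_mul α p.1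
    have h₂ := succ_mul γ p.2
    rw [← hp']
    linear_combination negBinomCoeff γ p.2 * h₁ + negBinomCoeff α p.1 * h₂

theorem one_add_le_pow {y : ℝ} (hy : 0 ≤ y) (n : ℕ) :
    negBinomCoeff (1 + y) n ≤ (1 + y) ^ n := by
  induction n with
  | zero => simp
  | succ n ih =>
    rw [succ, pow_succ]
    refine mul_le_mul ih ?_ (by positivity) (by positivity)
    rw [div_le_iff₀ (by positivity)]
    nlinarith [mul_nonneg hy (n.cast_nonneg : (0 : ℝ) ≤ n)]

theorem one_add_le_pow_mul_rpow {y : ℝ} (hy : 0 ≤ y) {M n : ℕ} (hM : 0 < M) (hn : M ≤ n) :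
    negBinomCoeff (1 + y) n ≤ (1 + y) ^ M * ((n : ℝ) / M) ^ y := by
  have hM' : (0 : ℝ) < M := by exact_mod_cast hM
  induction n, hn using Nat.le_induction with
  | base => simpa [hM'.ne'] using one_add_le_pow hy M
  | succ n hn ih =>
    have hn0 : (0 : ℝ) < n := by exact_mod_cast hM.trans_le hn
    have hstep : (1 + y + n) / (n + 1) ≤ (((n : ℝ) + 1) / n) ^ y := by
      have hlog := Real.one_sub_inv_le_log_of_pos (show 0 < ((n : ℝ) + 1) / n by positivity)
      rw [Real.rpow_def_of_pos (by positivity)]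
      refine le_trans ?_ (Real.add_one_le_exp _)
      have heq : (1 + y + n) / ((n : ℝ) + 1) = (1 - (((n : ℝ) + 1) / n)⁻¹) * y + 1 := by
        field_simp
        ring
      rw [heq]
      gcongr
    have hmul : (((n + 1 : ℕ) : ℝ) / M) ^ y = ((n : ℝ) / M) ^ y * (((n : ℝ) + 1) / n) ^ y := by
      rw [← Real.mul_rpow (by positivity) (by positivity)]
      congr 1
      push_cast
      field_simp
    rw [succ, hmul, ← mul_assoc]
    exact mul_le_mul ih hstep (by positivity) (by positivity)

theorem tendsto_rpow_mul {α : ℝ} (hα : 0 < α) :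
    Tendsto (fun n : ℕ => (n : ℝ) ^ (1 - α) * negBinomCoeff α n) atTop
      (𝓝 (Real.Gamma α)⁻¹) := by
  have hΓ := (Real.GammaSeq_tendsto_Gamma α).inv₀ (Real.Gamma_pos_of_pos hα).ne'
  have hfrac : Tendsto (fun n : ℕ => (n : ℝ) / (n + α)) atTop (𝓝 1) :=
    tendsto_natCast_div_add_atTop α
  have hmul := hΓ.mul hfrac
  rw [mul_one] at hmul
  refine hmul.congr' ?_
  filter_upwards [eventually_gt_atTop 0] with n hn
  have hn0 : (0 : ℝ) < n := by exact_mod_cast hn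
  have hprod : (∏ j ∈ range n, ((j : ℝ) + 1)) = (n.factorial : ℝ) := by
    rw [← prod_range_add_one_eq_factorial]
    push_cast
    rfl
  have hrpow : (n : ℝ) ^ α ≠ 0 := (Real.rpow_pos_of_pos hn0 α).ne'
  have hfact : (n.factorial : ℝ) ≠ 0 := by positivity
  rw [Real.GammaSeq, negBinomCoeff, prod_div_distrib, hprod, prod_range_succ,
    Real.rpow_sub hn0, Real.rpow_one]
  field_simp
  ring

end negBinomCoeff

theorem summable_one_add_mul_pow_mul_geometric {β r : ℝ} (hβ0 : 0 ≤ β) (hβ1 : β ≤ 1)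
    (hr0 : 0 < r) (hr1 : r < 1) (M : ℕ) :
    Summable fun k : ℕ => (1 + β * k) ^ M * r ^ k := by
  have hgeom : Summable fun k : ℕ => (k : ℝ) ^ M * r ^ k :=
    summable_pow_mul_geometric_of_norm_lt_one M (by rwa [Real.norm_of_nonneg hr0.le])
  have hshift := ((summable_nat_add_iff 1).2 hgeom).mul_left r⁻¹
  refine Summable.of_nonneg_of_le (fun k => by positivity) (fun k => ?_) hshift
  have hpow : (1 + β * k) ^ M ≤ ((k + 1 : ℕ) : ℝ) ^ M := by
    gcongr
    push_cast
    nlinarith [(k.cast_nonneg : (0 : ℝ) ≤ k)]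
  calc (1 + β * k) ^ M * r ^ k ≤ ((k + 1 : ℕ) : ℝ) ^ M * r ^ k := by gcongr
    _ = r⁻¹ * (((k + 1 : ℕ) : ℝ) ^ M * r ^ (k + 1)) := by
      rw [pow_succ]
      field_simp

/-- The `n`-th Taylor coefficient of `(1 - x) ^ (β - 1) / ((1 - x) ^ β + ε)` at `0`, which is a
discrete analogue of the Mittag-Leffler function. -/
noncomputable def discreteMittagLeffler (β ε : ℝ) (n : ℕ) : ℝ :=
  ∑' k : ℕ, (-ε) ^ k * negBinomCoeff (1 + β * k) n

section discrete

variable {β ε : ℝ}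

theorem summable_discreteMittagLeffler (hβ0 : 0 < β) (hβ1 : β < 1) (hε0 : 0 < ε) (hε1 : ε < 1)
    (n : ℕ) : Summable fun k : ℕ => (-ε) ^ k * negBinomCoeff (1 + β * k) n := by
  refine Summable.of_norm_bounded
    (summable_one_add_mul_pow_mul_geometric hβ0.le hβ1.le hε0 hε1 n) fun k => ?_
  have hc := negBinomCoeff.pos (show 0 < 1 + β * k by positivity) n
  rw [norm_mul, norm_pow, norm_neg, Real.norm_of_nonneg hε0.le, Real.norm_of_nonneg hc.le,
    mul_comm]
  gcongr
  exact negBinomCoeff.one_add_le_pow (by positivity) n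

theorem sum_antidiagonal_mul_discreteMittagLeffler (hβ0 : 0 < β) (hβ1 : β < 1) (hε0 : 0 < ε)
    (hε1 : ε < 1) (n : ℕ) :
    ∑ p ∈ antidiagonal n, negBinomCoeff (-β) p.1 * discreteMittagLeffler β ε p.2 =
      negBinomCoeff (1 - β) n - ε * discreteMittagLeffler β ε n := by
  have hsum := summable_discreteMittagLeffler hβ0 hβ1 hε0 hε1
  have hconv : ∀ k : ℕ, ∑ p ∈ antidiagonal n,
      negBinomCoeff (-β) p.1 * ((-ε) ^ k * negBinomCoeff (1 + β * k) p.2) =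
      (-ε) ^ k * negBinomCoeff (-β + (1 + β * k)) n := fun k => by
    rw [← negBinomCoeff.sum_antidiagonal_mul, mul_sum]
    exact sum_congr rfl fun p _ => by ring
  have hshift : ∀ k : ℕ, (-ε) ^ (k + 1) * negBinomCoeff (-β + (1 + β * (k + 1 : ℕ))) n =
      -ε * ((-ε) ^ k * negBinomCoeff (1 + β * k) n) := fun k => by
    rw [show -β + (1 + β * (k + 1 : ℕ)) = 1 + β * k by push_cast; ring]
    ring
  have hsummable : Summable fun k : ℕ => (-ε) ^ k * negBinomCoeff (-β + (1 + β * k)) n := by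
    rw [← summable_nat_add_iff 1]
    exact ((hsum n).mul_left (-ε)).congr fun k => (hshift k).symm
  have hzero : -β + (1 + β * (0 : ℕ)) = 1 - β := by
    push_cast
    ring
  calc ∑ p ∈ antidiagonal n, negBinomCoeff (-β) p.1 * discreteMittagLeffler β ε p.2
      = ∑ p ∈ antidiagonal n, ∑' k : ℕ,
          negBinomCoeff (-β) p.1 * ((-ε) ^ k * negBinomCoeff (1 + β * k) p.2) :=
        sum_congr rfl fun p _ => tsum_mul_left.symm
    _ = ∑' k : ℕ, (-ε) ^ k * negBinomCoeff (-β + (1 + β * k)) n := by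
        have hterm : ∀ p ∈ antidiagonal n, Summable fun k : ℕ =>
            negBinomCoeff (-β) p.1 * ((-ε) ^ k * negBinomCoeff (1 + β * k) p.2) :=
          fun p _ => (hsum p.2).mul_left _
        exact (Summable.tsum_finsetSum hterm).symm.trans (tsum_congr hconv)
    _ = negBinomCoeff (1 - β) n + -ε * discreteMittagLeffler β ε n := by
        rw [hsummable.tsum_eq_zero_add, tsum_congr hshift, tsum_mul_left, hzero, pow_zero,
          one_mul, discreteMittagLeffler]
    _ = negBinomCoeff (1 - β) n - ε * discreteMittagLeffler β ε n := by ring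

theorem le_discreteMittagLeffler (hβ0 : 0 < β) (hβ1 : β < 1) (hε0 : 0 < ε) (hε1 : ε < 1)
    (n : ℕ) :
    negBinomCoeff (1 - β) n / (negBinomCoeff (1 - β) n + ε) ≤ discreteMittagLeffler β ε n := by
  have hpos := negBinomCoeff.pos (sub_pos.2 hβ1)
  induction n using Nat.strong_induction_on with
  | _ n ih =>
    set d := negBinomCoeff (1 - β) with hd
    cases n with
    | zero =>
      have hrec := sum_antidiagonal_mul_discreteMittagLeffler hβ0 hβ1 hε0 hε1 0
      simp only [Finset.Nat.antidiagonal_zero, one_mul, sum_singleton, negBinomCoeff.zero_right] at hrec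
      rw [hd, negBinomCoeff.zero_right, div_le_iff₀ (by positivity)]
      linarith
    | succ n =>
      have hrec := sum_antidiagonal_mul_discreteMittagLeffler hβ0 hβ1 hε0 hε1 (n + 1)
      have htotal := negBinomCoeff.sum_antidiagonal_mul (-β) 1 (n + 1)
      rw [Finset.Nat.sum_antidiagonal_succ] at hrec htotal
      simp only [negBinomCoeff.zero_right, negBinomCoeff.one_left, mul_one, one_mul,
        neg_add_eq_sub] at hrec htotal
      rw [← hd] at hrec htotal
      set l := d (n + 1) / (d (n + 1) + ε) with hl
      have hdl : (d (n + 1) + ε) * l = d (n + 1) :=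
        mul_div_cancel₀ _ (by linarith [hpos (n + 1)])
      have hle : ∑ p ∈ antidiagonal n,
          negBinomCoeff (-β) (p.1 + 1) * discreteMittagLeffler β ε p.2 ≤
          (∑ p ∈ antidiagonal n, negBinomCoeff (-β) (p.1 + 1)) * l := by
        rw [sum_mul]
        refine sum_le_sum fun p hp => ?_
        refine mul_le_mul_of_nonpos_left ?_ (negBinomCoeff.neg_nonpos hβ0 hβ1 p.1)
        have hp2 : p.2 < n + 1 := by
          have := mem_antidiagonal.1 hp
          omega
        refine le_trans ?_ (ih p.2 hp2)
        have hanti : d (n + 1) ≤ d p.2 :=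
          negBinomCoeff.antitone (sub_pos.2 hβ1) (by linarith) hp2.le
        rw [hl, div_le_div_iff₀ (by linarith [hpos (n + 1)]) (by linarith [hpos p.2])]
        nlinarith
      rw [eq_sub_of_add_eq' htotal] at hle
      have hfinal : (1 + ε) * l ≤ (1 + ε) * discreteMittagLeffler β ε (n + 1) := by
        linarith
      exact le_of_mul_le_mul_left hfinal (by linarith)

end discrete

theorem tendsto_discreteMittagLeffler {β x : ℝ} (hβ0 : 0 < β) (hβ1 : β < 1) (hx : 0 < x) :
    Tendsto (fun n : ℕ => discreteMittagLeffler β (x * (n : ℝ) ^ (-β)) n) atTop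
      (𝓝 (mittagLeffler β (-x))) := by
  have hsmall : Tendsto (fun n : ℕ => x * (n : ℝ) ^ (-β)) atTop (𝓝 0) := by
    simpa using ((tendsto_rpow_neg_atTop hβ0).comp tendsto_natCast_atTop_atTop).const_mul x
  obtain ⟨M, hM1, hM0⟩ :=
    ((hsmall.eventually_lt_const one_pos).and (eventually_gt_atTop 0)).exists
  have hM' : (0 : ℝ) < M := by exact_mod_cast hM0
  have hpow : ∀ n k : ℕ, ((n : ℝ) ^ (-β)) ^ k = (n : ℝ) ^ (-(β * k)) :=
    fun n k => by
      rw [← Real.rpow_natCast, ← Real.rpow_mul n.cast_nonneg, neg_mul]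
  refine tendsto_tsum_of_dominated_convergence
    (summable_one_add_mul_pow_mul_geometric hβ0.le hβ1.le (by positivity) hM1 M)
    (fun k => ?_) ?_
  · have h := (negBinomCoeff.tendsto_rpow_mul
      (show 0 < 1 + β * k by positivity)).const_mul ((-x) ^ k)
    rw [add_comm (1 : ℝ), ← div_eq_mul_inv] at h
    refine h.congr fun n => ?_
    rw [← neg_mul, mul_pow, hpow, mul_assoc, add_comm (β * (k : ℝ)), sub_add_cancel_left]
  · filter_upwards [eventually_ge_atTop M] with n hn k
    have hn0 : (0 : ℝ) < n := by exact_mod_cast hM0.trans_le hn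
    have hc := negBinomCoeff.pos (show 0 < 1 + β * k by positivity) n
    have hbound := negBinomCoeff.one_add_le_pow_mul_rpow
      (show 0 ≤ β * k by positivity) hM0 hn
    rw [norm_mul, norm_pow, norm_neg, Real.norm_of_nonneg (by positivity),
      Real.norm_of_nonneg hc.le, mul_pow, mul_pow, hpow, hpow]
    calc x ^ k * (n : ℝ) ^ (-(β * k)) * negBinomCoeff (1 + β * k) n
        ≤ x ^ k * (n : ℝ) ^ (-(β * k)) * ((1 + β * k) ^ M * ((n : ℝ) / M) ^ (β * k)) := by
          gcongr
      _ = (1 + β * k) ^ M * (x ^ k * (M : ℝ) ^ (-(β * k))) := by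
          have hne : (n : ℝ) ^ (β * k) ≠ 0 := (Real.rpow_pos_of_pos hn0 _).ne'
          rw [Real.div_rpow hn0.le hM'.le, Real.rpow_neg hn0.le, Real.rpow_neg hM'.le]
          field_simp

/-- The lower bound `1 / (1 + Γ(1 - β) x) ≤ E_β(-x)`. -/
theorem one_div_le_mittagLeffler {β x : ℝ} (hβ0 : 0 < β) (hβ1 : β < 1) (hx : 0 < x) :
    1 / (1 + Real.Gamma (1 - β) * x) ≤ mittagLeffler β (-x) := by
  have hΓ := Real.Gamma_pos_of_pos (sub_pos.2 hβ1)
  have hd := negBinomCoeff.tendsto_rpow_mul (sub_pos.2 hβ1)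
  have hlim : Tendsto (fun n : ℕ => (n : ℝ) ^ (1 - (1 - β)) * negBinomCoeff (1 - β) n /
      ((n : ℝ) ^ (1 - (1 - β)) * negBinomCoeff (1 - β) n + x)) atTop
      (𝓝 ((Real.Gamma (1 - β))⁻¹ / ((Real.Gamma (1 - β))⁻¹ + x))) :=
    hd.div (hd.add_const x) (by positivity)
  have heq : (Real.Gamma (1 - β))⁻¹ / ((Real.Gamma (1 - β))⁻¹ + x) =
      1 / (1 + Real.Gamma (1 - β) * x) := by
    field_simp
  rw [heq] at hlim
  have hsmall : Tendsto (fun n : ℕ => x * (n : ℝ) ^ (-β)) atTop (𝓝 0) := by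
    simpa using ((tendsto_rpow_neg_atTop hβ0).comp tendsto_natCast_atTop_atTop).const_mul x
  refine le_of_tendsto_of_tendsto hlim (tendsto_discreteMittagLeffler hβ0 hβ1 hx) ?_
  filter_upwards [eventually_gt_atTop 0, hsmall.eventually_lt_const one_pos] with n hn hn1
  have hn0 : (0 : ℝ) < n := by exact_mod_cast hn
  refine le_trans (le_of_eq ?_)
    (le_discreteMittagLeffler hβ0 hβ1 (show 0 < x * (n : ℝ) ^ (-β) by positivity) hn1 n)
  have hc := negBinomCoeff.pos (sub_pos.2 hβ1) n
  have hpow : 0 < (n : ℝ) ^ β := Real.rpow_pos_of_pos hn0 β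
  rw [sub_sub_cancel, Real.rpow_neg hn0.le]
  field_simp

/-- For `0 < β < 1`, `a > 0` and `t ≥ 0`, the series
`Σ_{h=1}^∞ E_β(−a (t+h)^β)` diverges, i.e. the family
`h ↦ E_β(−a (t+h)^β)`, `h ∈ {1,2,3,…}`, is not summable. -/
theorem not_summable_mittagLeffler (β a t : ℝ) (hβ0 : 0 < β) (hβ1 : β < 1)
    (ha : 0 < a) (ht : 0 ≤ t) :
    ¬ Summable (fun h : ℕ => mittagLeffler β (-(a * (t + (h + 1 : ℕ)) ^ β))) := by
  intro hsum
  have hΓ := Real.Gamma_pos_of_pos (sub_pos.2 hβ1)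
  set C := (1 + Real.Gamma (1 - β) * a) * (t + 1) with hC
  have hC0 : 0 < C := by positivity
  have hharm : Summable fun h : ℕ => C⁻¹ * (1 / ((h + 1 : ℕ) : ℝ)) := by
    refine Summable.of_nonneg_of_le (fun h => by positivity) (fun h => ?_) hsum
    refine le_trans ?_ (one_div_le_mittagLeffler hβ0 hβ1 (by positivity))
    rw [inv_eq_one_div, one_div_mul_one_div]
    have h1 : (1 : ℝ) ≤ (h + 1 : ℕ) := by exact_mod_cast Nat.le_add_left 1 h
    set m : ℝ := ((h + 1 : ℕ) : ℝ)
    have hrpow : (t + m) ^ β ≤ t + m := by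
      simpa using Real.rpow_le_rpow_of_exponent_le (show 1 ≤ t + m by linarith) hβ1.le
    have hΓa : 0 < Real.Gamma (1 - β) * a := by positivity
    refine one_div_le_one_div_of_le (by positivity) ?_
    calc 1 + Real.Gamma (1 - β) * (a * (t + m) ^ β)
        ≤ (t + m) + Real.Gamma (1 - β) * (a * (t + m)) := by
          gcongr
          linarith
      _ = (1 + Real.Gamma (1 - β) * a) * (t + m) := by ring
      _ ≤ (1 + Real.Gamma (1 - β) * a) * ((t + 1) * m) := by
          gcongr
          nlinarith
      _ = C * m := by rw [hC]; ring
  rw [summable_mul_left_iff (inv_ne_zero hC0.ne')] at hharm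
  exact Real.not_summable_one_div_natCast ((summable_nat_add_iff 1).1 hharm)
end

section
/- Let 0 < β < 1, γ > 0, t ≥ 0, let Ψ : ℕ → ℝ be a nonnegative sequence, and let C : ℕ → ℝ be a nonnegative sequence with C_{l₀} > 0 for at least one index l₀. Then the double series Σ_{h=1}^∞ Σ_{l=0}^∞ ((2l+1)/(2π)) C_l E_β(−t^β(γ+Ψ_l)) E_β(−(t+h)^β(γ+Ψ_l)) diverges (the doubly-indexed family is not summable). In other words, the random field solving the time-fractional equation (γ − D_M + ∂^β/∂t^β)X_t = 0 exhibits long-range dependence. -/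
open MeasureTheory Set Filter Topology in
theorem intervalIntegrable_real_beta {u v : ℝ} (hu : 0 < u) (hv : 0 < v) :
    IntervalIntegrable (fun y : ℝ => y ^ (u - 1) * (1 - y) ^ (v - 1)) volume 0 1 := by
  have h := Complex.betaIntegral_convergent (u := (u : ℂ)) (v := (v : ℂ)) (by simpa) (by simpa)
  rw [intervalIntegrable_iff, uIoc_of_le zero_le_one] at h ⊢
  refine IntegrableOn.congr_fun (Integrable.re h) (fun y hy => ?_) measurableSet_Ioc
  have h1 : (0 : ℝ) ≤ 1 - y := by linarith [hy.2]
  have e1 : ((y : ℂ) ^ ((u : ℂ) - 1)) = ((y ^ (u - 1) : ℝ) : ℂ) := by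
    rw [Complex.ofReal_cpow hy.1.le]; push_cast; rfl
  have e2 : ((1 - (y : ℂ)) ^ ((v : ℂ) - 1)) = (((1 - y) ^ (v - 1) : ℝ) : ℂ) := by
    rw [Complex.ofReal_cpow h1]; push_cast; rfl
  simp only [e1, e2, ← Complex.ofReal_mul]
  exact Complex.ofReal_re _

open MeasureTheory Set Filter Topology in
theorem integral_real_beta {u v : ℝ} (hu : 0 < u) (hv : 0 < v) :
    ∫ y in (0 : ℝ)..1, y ^ (u - 1) * (1 - y) ^ (v - 1) =
      Real.Gamma u * Real.Gamma v / Real.Gamma (u + v) := by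
  have h := ProbabilityTheory.beta_eq_betaIntegralReal u v hu hv
  rw [ProbabilityTheory.beta, Complex.betaIntegral] at h
  rw [h]
  have : ∫ y in (0 : ℝ)..1, (y : ℂ) ^ ((u : ℂ) - 1) * (1 - (y : ℂ)) ^ ((v : ℂ) - 1) =
      ∫ y in (0 : ℝ)..1, ((y ^ (u - 1) * (1 - y) ^ (v - 1) : ℝ) : ℂ) := by
    refine intervalIntegral.integral_congr fun y hy => ?_
    rw [uIcc_of_le zero_le_one] at hy
    have h1 : (0 : ℝ) ≤ 1 - y := by linarith [hy.2]
    rw [Complex.ofReal_mul, Complex.ofReal_cpow hy.1, Complex.ofReal_cpow h1]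
    push_cast
    rfl
  rw [this, intervalIntegral.integral_ofReal, Complex.ofReal_re]

theorem one_sub_rpow_le {a y : ℝ} (ha : 0 < a) (hy0 : 0 ≤ y) (hy1 : y ≤ 1) :
    1 - y ^ a ≤ max 1 a * (1 - y) := by
  rcases le_total a 1 with h | h
  · have := Real.rpow_le_rpow_of_exponent_ge' hy0 hy1 ha.le h
    rw [Real.rpow_one] at this
    rw [max_eq_left h]
    linarith
  · have := one_add_mul_self_le_rpow_one_add (s := y - 1) (by linarith) h
    rw [add_sub_cancel] at this
    rw [max_eq_right h]
    linarith

/-- The kernel of the Marchaud-type form of the fractional derivative applied to a power. -/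
theorem marchaud_kernel_bounds {a β y : ℝ} (ha : 0 < a) (hβ : 0 < β) (hy0 : 0 ≤ y) (hy1 : y ≤ 1) :
    0 ≤ (1 - y ^ a) * (β * (1 - y) ^ (-β - 1)) ∧
      (1 - y ^ a) * (β * (1 - y) ^ (-β - 1)) ≤ max 1 a * β * (1 - y) ^ (-β) := by
  have hpow : y ^ a ≤ 1 := Real.rpow_le_one hy0 hy1 ha.le
  have h1 : 0 ≤ (1 - y) ^ (-β - 1) := Real.rpow_nonneg (by linarith) _
  refine ⟨mul_nonneg (by linarith) (by positivity), ?_⟩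
  rcases hy1.eq_or_lt with rfl | hlt
  · rw [Real.one_rpow, sub_self, zero_mul]
    have : (0:ℝ) ≤ 0 ^ (-β) := Real.rpow_nonneg le_rfl _
    positivity
  · have e : (1 - y) ^ (-β) = (1 - y) * (1 - y) ^ (-β - 1) := by
      rw [Real.rpow_sub_one (by linarith)]
      field_simp [(by linarith : (1 - y) ≠ 0)]
    calc (1 - y ^ a) * (β * (1 - y) ^ (-β - 1))
        ≤ (max 1 a * (1 - y)) * (β * (1 - y) ^ (-β - 1)) := by
          gcongr
          exact one_sub_rpow_le ha hy0 hy1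
      _ = _ := by rw [e]; ring

open MeasureTheory Set Filter Topology in
theorem intervalIntegrable_marchaud {a β : ℝ} (ha : 0 < a) (hβ : 0 < β) (hβ1 : β < 1) :
    IntervalIntegrable (fun y : ℝ => (1 - y ^ a) * (β * (1 - y) ^ (-β - 1))) volume 0 1 := by
  have h : IntervalIntegrable (fun y : ℝ => max 1 a * β * (1 - y) ^ (-β)) volume 0 1 := by
    have := (intervalIntegral.intervalIntegrable_rpow' (a := 0) (b := 1)
      (by linarith : -1 < -β)).comp_sub_left 1
    simp only [sub_zero, sub_self] at this
    exact this.symm.const_mul _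
  refine h.mono_fun' (Measurable.aestronglyMeasurable (by fun_prop)) ?_
  rw [uIoc_of_le zero_le_one]
  filter_upwards [ae_restrict_mem measurableSet_Ioc] with y hy
  have := marchaud_kernel_bounds ha hβ hy.1.le hy.2
  rw [Real.norm_of_nonneg this.1]
  exact this.2

open MeasureTheory Set Filter Topology in
theorem integral_marchaud {a β : ℝ} (ha : 0 < a) (hβ : 0 < β) (hβ1 : β < 1) :
    ∫ y in (0 : ℝ)..1, (1 - y ^ a) * (β * (1 - y) ^ (-β - 1)) =
      Real.Gamma (a + 1) * Real.Gamma (1 - β) / Real.Gamma (a + 1 - β) - 1 := by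
  have hB := intervalIntegrable_real_beta ha (by linarith : 0 < 1 - β)
  have hM := intervalIntegrable_marchaud ha hβ hβ1
  have key := intervalIntegral.integral_eq_sub_of_hasDerivAt_of_tendsto (a := 0) (b := 1)
    (f := fun y : ℝ => (1 - y ^ a) * (1 - y) ^ (-β)) (fa := 1) (fb := 0)
    (f' := fun y : ℝ => (1 - y ^ a) * (β * (1 - y) ^ (-β - 1)) -
      a * (y ^ (a - 1) * (1 - y) ^ (1 - β - 1))) zero_lt_one ?_ (hM.sub (hB.const_mul a)) ?_ ?_
  · rw [intervalIntegral.integral_sub hM (hB.const_mul a), intervalIntegral.integral_const_mul,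
      integral_real_beta ha (by linarith)] at key
    rw [Real.Gamma_add_one ha.ne', show a + 1 - β = a + (1 - β) by ring, mul_assoc, mul_div_assoc]
    linarith
  · intro y hy
    have h1 : (1 - y) ≠ 0 := by linarith [hy.2]
    have d1 := (Real.hasDerivAt_rpow_const (x := y) (p := a) (Or.inl hy.1.ne')).const_sub 1
    have d2 := ((hasDerivAt_id y).const_sub 1).rpow_const (p := -β) (Or.inl h1)
    convert! d1.mul d2 using 1
    simp only [id]
    rw [show 1 - β - 1 = -β by ring]
    ring
  · have : ContinuousAt (fun y : ℝ => (1 - y ^ a) * (1 - y) ^ (-β)) 0 := by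
      refine ContinuousAt.mul ?_ ?_
      · exact continuousAt_const.sub (Real.continuousAt_rpow_const _ _ (Or.inr ha.le))
      · exact (continuousAt_const.sub continuousAt_id).rpow_const (Or.inl (by norm_num))
    have h := this.tendsto
    simp only [Real.zero_rpow ha.ne', sub_zero, Real.one_rpow, mul_one] at h
    exact h.mono_left nhdsWithin_le_nhds
  · have hlim : Tendsto (fun y : ℝ => max 1 a * (1 - y) ^ (1 - β)) (𝓝[<] 1) (𝓝 0) := by
      have : ContinuousAt (fun y : ℝ => max 1 a * (1 - y) ^ (1 - β)) 1 :=
        continuousAt_const.mul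
          ((continuousAt_const.sub continuousAt_id).rpow_const (Or.inr (by linarith)))
      have h := this.tendsto
      simp only [sub_self, Real.zero_rpow (by linarith : 1 - β ≠ 0), mul_zero] at h
      exact h.mono_left nhdsWithin_le_nhds
    refine squeeze_zero' ?_ ?_ hlim
    all_goals
      filter_upwards [Ioo_mem_nhdsLT zero_lt_one] with y hy
      have h1 : 0 < 1 - y := by linarith [hy.2]
    · exact mul_nonneg (by linarith [Real.rpow_le_one hy.1.le hy.2.le ha.le])
        (Real.rpow_nonneg h1.le _)
    · rw [show 1 - β = 1 + -β by ring, Real.rpow_add h1, Real.rpow_one, ← mul_assoc]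
      gcongr
      exact one_sub_rpow_le ha hy.1.le hy.2.le

theorem rpow_mul_Gamma_le_Gamma_add {s β : ℝ} (hs : 0 < s) (hβ : 0 < β) (hβ1 : β < 1) :
    s ^ β * Real.Gamma (s + 1 - β) ≤ Real.Gamma (s + 1) := by
  have h := Real.Gamma_mul_add_mul_le_rpow_Gamma_mul_rpow_Gamma hs (by linarith : 0 < s + 1) hβ
    (by linarith : 0 < 1 - β) (by ring)
  have hG := Real.Gamma_pos_of_pos hs
  rw [show β * s + (1 - β) * (s + 1) = s + 1 - β by ring, Real.Gamma_add_one hs.ne',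
    Real.mul_rpow hs.le hG.le] at h
  rw [Real.Gamma_add_one hs.ne']
  calc s ^ β * Real.Gamma (s + 1 - β)
      ≤ s ^ β * (Real.Gamma s ^ β * (s ^ (1 - β) * Real.Gamma s ^ (1 - β))) := by gcongr
    _ = (s ^ β * s ^ (1 - β)) * (Real.Gamma s ^ β * Real.Gamma s ^ (1 - β)) := by ring
    _ = _ := by
      rw [← Real.rpow_add hs, ← Real.rpow_add hG]
      simp

open Filter Topology in
theorem summable_mittagLeffler {β : ℝ} (hβ : 0 < β) (hβ1 : β < 1) (x : ℝ) :
    Summable fun k : ℕ => x ^ k / Real.Gamma (β * k + 1) := by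
  refine summable_of_ratio_norm_eventually_le (r := 1 / 2) (by norm_num) ?_
  have hlim : Tendsto (fun k : ℕ => (β * ((k : ℝ) + 1)) ^ β) atTop atTop :=
    (tendsto_rpow_atTop hβ).comp ((tendsto_natCast_atTop_atTop.atTop_add
      tendsto_const_nhds).const_mul_atTop hβ)
  filter_upwards [hlim.eventually_ge_atTop (2 * |x|)] with k hk
  have hs : 0 < β * ((k : ℝ) + 1) := by positivity
  have h := rpow_mul_Gamma_le_Gamma_add hs hβ hβ1
  rw [show β * ((k : ℝ) + 1) + 1 - β = β * k + 1 by ring] at h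
  have hG : 0 < Real.Gamma (β * k + 1) := Real.Gamma_pos_of_pos (by positivity)
  have hG' : 0 < Real.Gamma (β * ((k : ℝ) + 1) + 1) := Real.Gamma_pos_of_pos (by positivity)
  push_cast
  rw [norm_div, norm_div, norm_pow, norm_pow, Real.norm_of_nonneg hG.le, Real.norm_of_nonneg hG'.le,
    Real.norm_eq_abs, ← mul_div_assoc, div_le_div_iff₀ hG' hG]
  have h2 : 2 * |x| * Real.Gamma (β * k + 1) ≤ Real.Gamma (β * ((k : ℝ) + 1) + 1) :=
    (mul_le_mul_of_nonneg_right hk hG.le).trans h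
  calc |x| ^ (k + 1) * Real.Gamma (β * k + 1)
      = 1 / 2 * |x| ^ k * (2 * |x| * Real.Gamma (β * k + 1)) := by ring
    _ ≤ _ := by gcongr

theorem mittagLeffler_zero (β : ℝ) : mittagLeffler β 0 = 1 := by
  rw [mittagLeffler, tsum_eq_single 0 fun k hk => by simp [hk]]
  simp

open Set in
theorem continuousOn_mittagLeffler_neg {β : ℝ} (hβ : 0 < β) (hβ1 : β < 1) (X : ℝ) :
    ContinuousOn (fun x => mittagLeffler β (-x)) (Icc 0 X) := by
  unfold mittagLeffler
  refine continuousOn_tsum (fun k => by fun_prop) (summable_mittagLeffler hβ hβ1 X)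
    fun k x hx => ?_
  have hG : 0 < Real.Gamma (β * k + 1) := Real.Gamma_pos_of_pos (by positivity)
  rw [norm_div, norm_pow, norm_neg, Real.norm_of_nonneg hG.le, Real.norm_of_nonneg hx.1]
  gcongr
  exacts [hx.1, hx.2]

open MeasureTheory Set in
/-- The fractional relaxation equation for `y ↦ E_β(-x y^β)` at `y = 1`, with the fractional
derivative written in Marchaud form. -/
theorem mittagLeffler_marchaud {β : ℝ} (hβ : 0 < β) (hβ1 : β < 1) (x : ℝ) :
    (∫ y in (0 : ℝ)..1, (mittagLeffler β (-x) - mittagLeffler β (-(x * y ^ β))) *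
      (β * (1 - y) ^ (-β - 1))) + (mittagLeffler β (-x) - 1) =
      -(Real.Gamma (1 - β) * x * mittagLeffler β (-x)) := by
  set b : ℕ → ℝ := fun k => (-x) ^ k / Real.Gamma (β * k + 1) with hb
  have hbs : Summable b := summable_mittagLeffler hβ hβ1 (-x)
  set m : ℕ → ℝ := fun k => ∫ y in (0 : ℝ)..1,
    (1 - y ^ (β * ((k : ℝ) + 1))) * (β * (1 - y) ^ (-β - 1)) with hm
  have hbm (k : ℕ) : b (k + 1) * m k = -(Real.Gamma (1 - β) * x) * b k - b (k + 1) := by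
    have hG' : Real.Gamma (β * ((k : ℝ) + 1) + 1) ≠ 0 :=
      (Real.Gamma_pos_of_pos (by positivity)).ne'
    simp only [hm, hb]
    rw [integral_marchaud (by positivity) hβ hβ1,
      show β * ((k : ℝ) + 1) + 1 - β = β * k + 1 by ring]
    push_cast
    rw [pow_succ]
    field_simp
    ring
  have hbm_sum : Summable fun k => b (k + 1) * m k := by
    simp_rw [hbm]
    exact (hbs.mul_left _).sub ((summable_nat_add_iff 1).2 hbs)
  set F : ℕ → ℝ → ℝ := fun k y =>
    b (k + 1) * ((1 - y ^ (β * ((k : ℝ) + 1))) * (β * (1 - y) ^ (-β - 1))) with hF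
  have hFint (k : ℕ) : Integrable (F k) (volume.restrict (Ioc 0 1)) := by
    have := intervalIntegrable_marchaud (a := β * ((k : ℝ) + 1)) (by positivity) hβ hβ1
    rw [intervalIntegrable_iff, uIoc_of_le zero_le_one] at this
    exact this.const_mul _
  have hFnorm : Summable fun k => ∫ y in Ioc (0 : ℝ) 1, ‖F k y‖ := by
    refine hbm_sum.norm.congr fun k => ?_
    have hmk : 0 ≤ m k := by
      refine intervalIntegral.integral_nonneg zero_le_one fun y hy => ?_
      exact (marchaud_kernel_bounds (by positivity) hβ hy.1 hy.2).1
    rw [norm_mul, Real.norm_of_nonneg hmk, hm]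
    simp only
    rw [intervalIntegral.integral_of_le zero_le_one, ← integral_const_mul]
    refine setIntegral_congr_fun measurableSet_Ioc fun y hy => ?_
    simp only [hF]
    rw [norm_mul, Real.norm_of_nonneg (marchaud_kernel_bounds (by positivity) hβ hy.1.le hy.2).1]
  have hsum := hasSum_integral_of_summable_integral_norm hFint hFnorm
  have hFm (k : ℕ) : ∫ y in Ioc (0 : ℝ) 1, F k y = b (k + 1) * m k := by
    simp only [hF, hm]
    rw [intervalIntegral.integral_of_le zero_le_one, integral_const_mul]
  have hFsum (y : ℝ) (hy : y ∈ Ioc (0 : ℝ) 1) : ∑' k, F k y =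
      (mittagLeffler β (-x) - mittagLeffler β (-(x * y ^ β))) * (β * (1 - y) ^ (-β - 1)) := by
    have hs1 := (summable_mittagLeffler hβ hβ1 (-x)).hasSum
    have hs2 := (summable_mittagLeffler hβ hβ1 (-(x * y ^ β))).hasSum
    have hs := (hasSum_nat_add_iff' 1).2 (hs1.sub hs2)
    simp only [Finset.range_one, Finset.sum_singleton, pow_zero, sub_self, sub_zero] at hs
    rw [mittagLeffler, mittagLeffler, ← (hs.mul_right (β * (1 - y) ^ (-β - 1))).tsum_eq]
    refine tsum_congr fun k => ?_
    simp only [hF, hb]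
    have : y ^ (β * ((k : ℝ) + 1)) = (y ^ β) ^ (k + 1) := by
      rw [← Real.rpow_natCast, ← Real.rpow_mul hy.1.le]
      push_cast
      rfl
    rw [this, show -(x * y ^ β) = -x * y ^ β by ring, mul_pow]
    push_cast
    ring
  have hint : ∫ y in (0 : ℝ)..1, (mittagLeffler β (-x) - mittagLeffler β (-(x * y ^ β))) *
      (β * (1 - y) ^ (-β - 1)) = ∑' k, b (k + 1) * m k := by
    rw [intervalIntegral.integral_of_le zero_le_one,
      ← setIntegral_congr_fun measurableSet_Ioc hFsum, ← hsum.tsum_eq]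
    exact tsum_congr hFm
  have hE : mittagLeffler β (-x) = ∑' k, b k := rfl
  have hE' : mittagLeffler β (-x) = 1 + ∑' k, b (k + 1) := by
    rw [hE, hbs.tsum_eq_zero_add]
    simp [hb]
  rw [hint]
  simp_rw [hbm]
  rw [Summable.tsum_sub (hbs.mul_left _) ((summable_nat_add_iff 1).2 hbs), tsum_mul_left, ← hE]
  linarith

open Set in
theorem mittagLeffler_neg_lower_bound {β : ℝ} (hβ : 0 < β) (hβ1 : β < 1) {x : ℝ} (hx : 0 ≤ x) :
    1 / (1 + Real.Gamma (1 - β) * x) ≤ mittagLeffler β (-x) := by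
  set c := Real.Gamma (1 - β) with hc
  have hc0 : 0 < c := Real.Gamma_pos_of_pos (by linarith)
  have hcont : ContinuousOn (fun z => mittagLeffler β (-z) - 1 / (1 + c * z)) (Icc 0 x) := by
    refine (continuousOn_mittagLeffler_neg hβ hβ1 x).sub (continuousOn_const.div (by fun_prop) ?_)
    intro z hz
    have := mul_nonneg hc0.le hz.1
    positivity
  obtain ⟨z, hz, hmin⟩ := isCompact_Icc.exists_isMinOn (nonempty_Icc.2 hx) hcont
  by_contra! hlt
  have hneg : mittagLeffler β (-z) - 1 / (1 + c * z) < 0 :=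
    (hmin (right_mem_Icc.2 hx)).trans_lt (by simpa using hlt)
  have hz0 := hz.1
  have hint : ∫ y in (0 : ℝ)..1, (mittagLeffler β (-z) - mittagLeffler β (-(z * y ^ β))) *
      (β * (1 - y) ^ (-β - 1)) ≤ 0 := by
    rw [intervalIntegral.integral_of_le zero_le_one]
    refine MeasureTheory.setIntegral_nonpos measurableSet_Ioc fun y hy => ?_
    have hy1 : y ^ β ≤ 1 := Real.rpow_le_one hy.1.le hy.2 hβ.le
    have hy0 : 0 ≤ y ^ β := Real.rpow_nonneg hy.1.le _
    have hzy : z * y ^ β ≤ z := mul_le_of_le_one_right hz0 hy1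
    have h1 : mittagLeffler β (-z) - 1 / (1 + c * z) ≤
        mittagLeffler β (-(z * y ^ β)) - 1 / (1 + c * (z * y ^ β)) :=
      hmin ⟨by positivity, hzy.trans hz.2⟩
    have h2 : 1 / (1 + c * z) ≤ 1 / (1 + c * (z * y ^ β)) := by gcongr
    have h3 : 0 ≤ (1 - y) ^ (-β - 1) := Real.rpow_nonneg (by linarith [hy.2]) _
    exact mul_nonpos_of_nonpos_of_nonneg (by linarith) (by positivity)
  have hrel := mittagLeffler_marchaud hβ hβ1 z
  have hpos : 0 < 1 + c * z := by positivity
  have : 1 / (1 + c * z) ≤ mittagLeffler β (-z) := by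
    rw [div_le_iff₀ hpos]
    linarith
  linarith

/-- Let `0 < β < 1`, `γ > 0`, `t ≥ 0`, let `Ψ : ℕ → ℝ` be a nonnegative
sequence and `C : ℕ → ℝ` a nonnegative sequence with `C l₀ > 0` for some index `l₀`.
Then the double series
`Σ_{h=1}^∞ Σ_{l=0}^∞ ((2l+1)/(2π)) C_l E_β(−t^β(γ+Ψ_l)) E_β(−(t+h)^β(γ+Ψ_l))`
diverges: the doubly-indexed family (indexed by pairs `(h, l)` with `h ≥ 1`, `l ≥ 0`)
is not summable.  This is the long-range dependence of the solution of the
time-fractional equation `(γ − D_M + ∂^β/∂t^β) X_t = 0` on the sphere. -/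
theorem long_range_dependence (β γ t : ℝ) (hβ0 : 0 < β) (hβ1 : β < 1) (hγ : 0 < γ)
    (ht : 0 ≤ t) (Ψ C : ℕ → ℝ) (hΨ : ∀ l, 0 ≤ Ψ l) (hC : ∀ l, 0 ≤ C l)
    (l₀ : ℕ) (hCl₀ : 0 < C l₀) :
    ¬ Summable (fun p : ℕ × ℕ =>
        (2 * (p.2 : ℝ) + 1) / (2 * Real.pi) * C p.2 *
          mittagLeffler β (-(t ^ β * (γ + Ψ p.2))) *
          mittagLeffler β (-((t + (p.1 + 1 : ℕ)) ^ β * (γ + Ψ p.2)))) := by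
  intro hsum
  have hinj : Function.Injective fun h : ℕ => (h, l₀) := fun _ _ h => (Prod.mk.inj h).1
  have hs := hsum.comp_injective hinj
  simp only [Function.comp_def] at hs
  have hr : 0 < γ + Ψ l₀ := by linarith [hΨ l₀]
  set r := γ + Ψ l₀ with hr_def
  have hc0 : 0 < Real.Gamma (1 - β) := Real.Gamma_pos_of_pos (by linarith)
  set c := Real.Gamma (1 - β) with hc
  have hA : 0 < (2 * (l₀ : ℝ) + 1) / (2 * Real.pi) * C l₀ * mittagLeffler β (-(t ^ β * r)) := by
    have h0 : 0 ≤ t ^ β * r := mul_nonneg (Real.rpow_nonneg ht _) hr.le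
    have : 0 < mittagLeffler β (-(t ^ β * r)) :=
      lt_of_lt_of_le (by positivity) (mittagLeffler_neg_lower_bound hβ0 hβ1 h0)
    have := Real.pi_pos
    positivity
  have hs' := (summable_mul_left_iff hA.ne').1 hs
  have hK : 0 < 1 + c * ((t + 1) * r) := by positivity
  have hbound (h : ℕ) : (1 + c * ((t + 1) * r))⁻¹ * (1 / ((h + 1 : ℕ) : ℝ)) ≤
      mittagLeffler β (-((t + (h + 1 : ℕ)) ^ β * r)) := by
    have hh : (1 : ℝ) ≤ ((h + 1 : ℕ) : ℝ) := by exact_mod_cast Nat.le_add_left 1 h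
    set n : ℝ := ((h + 1 : ℕ) : ℝ)
    have htn : 1 ≤ t + n := by linarith
    have h1 : (t + n) ^ β ≤ (t + 1) * n := by
      calc (t + n) ^ β ≤ (t + n) ^ (1 : ℝ) := Real.rpow_le_rpow_of_exponent_le htn hβ1.le
        _ = t + n := Real.rpow_one _
        _ ≤ (t + 1) * n := by nlinarith
    refine le_trans ?_ (mittagLeffler_neg_lower_bound hβ0 hβ1 (by positivity))
    rw [← one_div, one_div_mul_one_div]
    have h2 : c * ((t + n) ^ β * r) ≤ c * ((t + 1) * n * r) := by gcongr
    refine one_div_le_one_div_of_le (by positivity) ?_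
    nlinarith
  have hs2 := Summable.of_nonneg_of_le (fun h => by positivity) hbound hs'
  have hs3 := (summable_mul_left_iff (inv_pos.2 hK).ne').1 hs2
  exact Real.not_summable_one_div_natCast
    ((summable_nat_add_iff (f := fun n : ℕ => 1 / (n : ℝ)) 1).1 hs3)
end

section
/- Let 0 < β ≤ 1, γ > 0, φ ≥ 0, t ≥ 0, let Ψ : ℕ → ℝ be a nonnegative sequence, and let C : ℕ → ℝ be a nonnegative bounded sequence. Set μ_l = l(l+1). Then the double series Σ_{h=1}^∞ Σ_{l=1}^∞ ((2l+1)/(4π)) C_l e^{−(2t+h) μ_l} (γ + φ μ_l + Ψ_l)^{−2β} converges (the doubly-indexed family over h ≥ 1, l ≥ 1 is summable). In other words, the random field solving (γ − D_M − φ ∂/∂t)^β X_t = T_t exhibits short-range dependence. -/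
/-- The majorant `(2l+1) e^{-h} e^{-l}`, over `h, l ≥ 1`, is summable. -/
theorem summable_exp_neg_mul_linear_exp_neg :
    Summable (fun p : ℕ × ℕ => Real.exp (-((p.1 + 1 : ℕ) : ℝ)) *
      ((2 * ((p.2 + 1 : ℕ) : ℝ) + 1) * Real.exp (-((p.2 + 1 : ℕ) : ℝ)))) := by
  have h0 : Summable (fun n : ℕ => Real.exp (-(n : ℝ))) := Real.summable_exp_neg_nat
  have h1 : Summable (fun n : ℕ => (2 * (n : ℝ) + 1) * Real.exp (-(n : ℝ))) := by
    have h := ((Real.summable_pow_mul_exp_neg_nat_mul 1 one_pos).mul_left 2).add h0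
    refine h.congr fun n => ?_
    simp only [pow_one, neg_mul, one_mul]
    ring
  exact ((summable_nat_add_iff 1).2 h0).mul_of_nonneg ((summable_nat_add_iff 1).2 h1)
    (fun _ => (Real.exp_pos _).le) (fun _ => by positivity)

/-- For `h, l ≥ 1`, the heat factor `e^{-(2t+h) l(l+1)}` is at most `e^{-h} e^{-l}`. -/
theorem exp_neg_mul_laplace_eigenvalue_le {t h l : ℝ} (ht : 0 ≤ t) (hh : 1 ≤ h) (hl : 1 ≤ l) :
    Real.exp (-(2 * t + h) * (l * (l + 1))) ≤ Real.exp (-h) * Real.exp (-l) := by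
  rw [← Real.exp_add, Real.exp_le_exp]
  have h1 : 0 ≤ t * (l * (l + 1)) := by positivity
  have h2 : 0 ≤ h * l * (l - 1) :=
    mul_nonneg (by positivity) (by linarith)
  nlinarith [mul_nonneg (sub_nonneg.2 hh) (sub_nonneg.2 hl)]

/-- Let `0 < β ≤ 1`, `γ > 0`, `φ ≥ 0`, `t ≥ 0`, let `Ψ : ℕ → ℝ` be a
nonnegative sequence and `C : ℕ → ℝ` a nonnegative bounded sequence, and set
`μ_l = l(l+1)`.  Then the double series
`Σ_{h=1}^∞ Σ_{l=1}^∞ ((2l+1)/(4π)) C_l e^{−(2t+h)μ_l} (γ + φ μ_l + Ψ_l)^{−2β}`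
converges: the doubly-indexed family (indexed by pairs `(h, l)` with `h ≥ 1`, `l ≥ 1`)
is summable.  This is the short-range dependence of the solution of
`(γ − D_M − φ ∂/∂t)^β X_t = T_t` on the sphere. -/
theorem short_range_dependence (β γ φ t : ℝ) (hβ0 : 0 < β) (hβ1 : β ≤ 1) (hγ : 0 < γ)
    (hφ : 0 ≤ φ) (ht : 0 ≤ t) (Ψ C : ℕ → ℝ) (hΨ : ∀ l, 0 ≤ Ψ l) (hC : ∀ l, 0 ≤ C l)
    (B : ℝ) (hCB : ∀ l, C l ≤ B) :
    Summable (fun p : ℕ × ℕ =>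
        (2 * ((p.2 + 1 : ℕ) : ℝ) + 1) / (4 * Real.pi) * C (p.2 + 1) *
          Real.exp (-(2 * t + (p.1 + 1 : ℕ)) *
            (((p.2 + 1 : ℕ) : ℝ) * (((p.2 + 1 : ℕ) : ℝ) + 1))) *
          (γ + φ * (((p.2 + 1 : ℕ) : ℝ) * (((p.2 + 1 : ℕ) : ℝ) + 1)) + Ψ (p.2 + 1)) ^
            (-(2 * β))) := by
  refine Summable.of_nonneg_of_le (fun p => ?_) (fun p => ?_)
    (summable_exp_neg_mul_linear_exp_neg.mul_left (B / (4 * Real.pi) * γ ^ (-(2 * β))))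
  · have := hC (p.2 + 1)
    have := hΨ (p.2 + 1)
    positivity
  · have hB := hCB (p.2 + 1)
    have hB0 : 0 ≤ B := (hC 0).trans (hCB 0)
    have hl : (1 : ℝ) ≤ ((p.2 + 1 : ℕ) : ℝ) := by exact_mod_cast Nat.le_add_left 1 p.2
    have hh : (1 : ℝ) ≤ ((p.1 + 1 : ℕ) : ℝ) := by exact_mod_cast Nat.le_add_left 1 p.1
    have hexp := exp_neg_mul_laplace_eigenvalue_le ht hh hl
    have hΨl := hΨ (p.2 + 1)
    generalize ((p.2 + 1 : ℕ) : ℝ) = l at *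
    generalize ((p.1 + 1 : ℕ) : ℝ) = h at *
    have hpow : (γ + φ * (l * (l + 1)) + Ψ (p.2 + 1)) ^ (-(2 * β)) ≤ γ ^ (-(2 * β)) := by
      refine Real.rpow_le_rpow_of_nonpos hγ ?_ (by linarith)
      have : 0 ≤ φ * (l * (l + 1)) := by positivity
      linarith
    calc _ ≤ (2 * l + 1) / (4 * Real.pi) * B * (Real.exp (-h) * Real.exp (-l)) *
          γ ^ (-(2 * β)) := by gcongr
      _ = _ := by ring
end
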